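/- arXiv:2311.12554 — 2 statements merged into one kernel-verified Lean document; each statement's English description precedes it below -/
import Mathlib

section
/- Suppose f : [0,1] → ℝ is (p+1)-times differentiable with |f^{(p+1)}(x)| ≤ C for all x ∈ [0,1], where p ≥ 1 is an integer. Let K > m ≥ 1 be integers, let T be the quantized tensor representation of f on D_K, and let ε > 0. Then the (ε,∞) rank of the m-th unfolding matrix of T satisfies r_m^{(ε,∞)}[T] ≤ 1 + p + ⌈((4C/π) · 2^{−m} / (p ε))^{1/p}⌉. -/
noncomputable section

/-- The Chebyshev–Lobatto node `c_N^α = (cos(πα/N)+1)/2`, shifted and scaled to `[0,1]`. -/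
def chebNode (N α : ℕ) : ℝ := (Real.cos (Real.pi * α / N) + 1) / 2

/-- The Lagrange cardinal polynomial `P_N^α` for the Chebyshev–Lobatto grid. -/
def chebP (N α : ℕ) (x : ℝ) : ℝ :=
  ∏ β ∈ (Finset.range (N + 1)).erase α,
    (x - chebNode N β) / (chebNode N α - chebNode N β)

/-- The real value of a bit. -/
def bitVal (b : Bool) : ℝ := if b then 1 else 0

/-- The quantized tensor representation of `f` on the dyadic grid `D_K`. -/
def qtt (f : ℝ → ℝ) (K : ℕ) (σ : Fin K → Bool) : ℝ :=
  f (∑ k : Fin K, (2 : ℝ) ^ (-(k.val + 1 : ℤ)) * bitVal (σ k))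

/-- The `(ε,∞)` rank of the `m`-th unfolding matrix of the tensor `T : {0,1}^K → ℝ`. -/
def epsRank (K m : ℕ) (hm : m ≤ K) (T : (Fin K → Bool) → ℝ) (ε : ℝ) : ℕ :=
  sInf { r : ℕ |
    ∃ TL : Fin r → (Fin m → Bool) → ℝ, ∃ TR : Fin r → (Fin (K - m) → Bool) → ℝ,
      ∀ σ : Fin K → Bool,
        |T σ - ∑ α : Fin r, TL α (fun i => σ (Fin.castLE hm i)) *
            TR α (fun i => σ (Fin.cast (Nat.add_sub_cancel' hm) (Fin.natAdd m i)))| ≤ ε }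

/-- The dyadic number with binary digits `σ`. -/
def dyadicVal {n : ℕ} (σ : Fin n → Bool) : ℝ :=
  ∑ k : Fin n, (2 : ℝ) ^ (-(k.val + 1 : ℤ)) * bitVal (σ k)

theorem dyadicVal_nonneg {n : ℕ} (σ : Fin n → Bool) : 0 ≤ dyadicVal σ := by
  refine Finset.sum_nonneg fun k _ => mul_nonneg (by positivity) ?_
  unfold bitVal
  split_ifs <;> norm_num

theorem dyadicVal_le_one {n : ℕ} (σ : Fin n → Bool) : dyadicVal σ ≤ 1 := by
  have hsum : ∀ n : ℕ, ∑ k ∈ Finset.range n, (2 : ℝ) ^ (-(k + 1 : ℤ)) = 1 - 2 ^ (-(n : ℤ)) := by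
    intro n
    induction n with
    | zero => simp
    | succ n ih =>
      rw [Finset.sum_range_succ, ih]
      push_cast
      rw [neg_add, zpow_add₀ two_ne_zero]
      norm_num
      ring
  calc dyadicVal σ ≤ ∑ k : Fin n, (2 : ℝ) ^ (-(k.val + 1 : ℤ)) := by
        refine Finset.sum_le_sum fun k _ => mul_le_of_le_one_right (by positivity) ?_
        unfold bitVal
        split_ifs <;> norm_num
    _ = 1 - 2 ^ (-(n : ℤ)) := by
        rw [Fin.sum_univ_eq_sum_range (fun k => (2 : ℝ) ^ (-(k + 1 : ℤ))), hsum]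
    _ ≤ 1 := sub_le_self _ (by positivity)

theorem dyadicVal_split {K m : ℕ} (hm : m ≤ K) (σ : Fin K → Bool) :
    dyadicVal σ = dyadicVal (fun i => σ (Fin.castLE hm i)) + (2 : ℝ) ^ (-(m : ℤ)) *
      dyadicVal (fun i => σ (Fin.cast (Nat.add_sub_cancel' hm) (Fin.natAdd m i))) := by
  unfold dyadicVal
  rw [← (finCongr (Nat.add_sub_cancel' hm)).sum_comp, Fin.sum_univ_add, Finset.mul_sum]
  congr 1
  refine Finset.sum_congr rfl fun i _ => ?_
  rw [← mul_assoc, ← zpow_add₀ two_ne_zero]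
  congr 2
  simp
  ring

theorem epsRank_le_two_pow (K m : ℕ) (hm : m ≤ K) (T : (Fin K → Bool) → ℝ) {ε : ℝ}
    (hε : 0 ≤ ε) : epsRank K m hm T ε ≤ 2 ^ m := by
  let e : Fin (2 ^ m) ≃ (Fin m → Bool) :=
    (Fintype.equivFinOfCardEq (by simp)).symm
  refine Nat.sInf_le ⟨fun α τ => if e.symm τ = α then 1 else 0,
    fun α ρ => T fun k => Fin.append (e α) ρ (Fin.cast (Nat.add_sub_cancel' hm).symm k),
    fun σ => ?_⟩
  simp only [ite_mul, one_mul, zero_mul, Finset.sum_ite_eq, Finset.mem_univ, if_true,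
    Equiv.apply_symm_apply]
  have hσ : (fun k => Fin.append (fun i => σ (Fin.castLE hm i))
      (fun i => σ (Fin.cast (Nat.add_sub_cancel' hm) (Fin.natAdd m i)))
      (Fin.cast (Nat.add_sub_cancel' hm).symm k)) = σ := by
    funext k
    obtain ⟨j, rfl⟩ := (finCongr (Nat.add_sub_cancel' hm)).surjective k
    refine Fin.addCases (fun i => ?_) (fun i => ?_) j
    · simp
      rfl
    · simp
  rw [hσ, sub_self, abs_zero]
  exact hε

theorem abs_sub_taylorWithinEval_le {f : ℝ → ℝ} {a b C : ℝ} {p : ℕ} (hab : a < b)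
    (hdiff : ∀ i ≤ p,
      DifferentiableOn ℝ (iteratedDerivWithin i f (Set.Icc a b)) (Set.Icc a b))
    (hC : ∀ x ∈ Set.Icc a b, |iteratedDerivWithin (p + 1) f (Set.Icc a b) x| ≤ C)
    {c x : ℝ} (hc : a ≤ c) (hcx : c ≤ x) (hx : x ≤ b) :
    |f x - taylorWithinEval f p (Set.Icc a b) c x| ≤ C * (x - c) ^ (p + 1) / p.factorial := by
  have hf : ContDiffOn ℝ p f (Set.Icc a b) :=
    contDiffOn_of_differentiableOn_deriv (n := (p : ℕ∞)) fun i hi => hdiff i (by exact_mod_cast hi)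
  have hsub : Set.Icc c x ⊆ Set.Icc a b := Set.Icc_subset_Icc hc hx
  have key := norm_image_sub_le_of_norm_deriv_le_segment'
    (f := fun t => taylorWithinEval f p (Set.Icc a b) t x) (a := c) (b := x)
    (C := (p.factorial : ℝ)⁻¹ * (x - c) ^ p * C)
    (fun t ht => (hasDerivWithinAt_taylorWithinEval_at_Icc x hab (hsub ht) hf
      (hdiff p le_rfl)).mono hsub)
    (fun t ht => by
      have hxt : 0 ≤ x - t := sub_nonneg.2 ht.2.le
      rw [norm_smul, Real.norm_eq_abs, Real.norm_eq_abs,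
        abs_of_nonneg (by positivity : 0 ≤ (p.factorial : ℝ)⁻¹ * (x - t) ^ p)]
      have hxc : 0 ≤ x - c := sub_nonneg.2 hcx
      gcongr
      · exact ht.1
      · exact hC t (hsub (Set.Ico_subset_Icc_self ht)))
    x (Set.right_mem_Icc.2 hcx)
  rw [taylorWithinEval_self, Real.norm_eq_abs] at key
  refine key.trans_eq ?_
  rw [pow_succ]
  ring

theorem epsRank_qtt_le_of_taylor_bound {f : ℝ → ℝ} {p : ℕ} {C : ℝ}
    (hdiff : ∀ i ≤ p,
      DifferentiableOn ℝ (iteratedDerivWithin i f (Set.Icc (0 : ℝ) 1)) (Set.Icc (0 : ℝ) 1))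
    (hC : ∀ x ∈ Set.Icc (0 : ℝ) 1, |iteratedDerivWithin (p + 1) f (Set.Icc (0 : ℝ) 1) x| ≤ C)
    {K m : ℕ} (hm : m ≤ K) {ε : ℝ}
    (hε : C * ((2 : ℝ) ^ (-(m : ℤ))) ^ (p + 1) / p.factorial ≤ ε) :
    epsRank K m hm (qtt f K) ε ≤ p + 1 := by
  refine Nat.sInf_le ⟨fun α τ => iteratedDerivWithin α f (Set.Icc (0 : ℝ) 1) (dyadicVal τ),
    fun α ρ => ((α : ℕ).factorial : ℝ)⁻¹ * ((2 : ℝ) ^ (-(m : ℤ)) * dyadicVal ρ) ^ (α : ℕ),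
    fun σ => ?_⟩
  set τ : Fin m → Bool := fun i => σ (Fin.castLE hm i)
  set ρ : Fin (K - m) → Bool :=
    fun i => σ (Fin.cast (Nat.add_sub_cancel' hm) (Fin.natAdd m i))
  have hsplit : dyadicVal σ = dyadicVal τ + (2 : ℝ) ^ (-(m : ℤ)) * dyadicVal ρ :=
    dyadicVal_split hm σ
  have hy : 0 ≤ (2 : ℝ) ^ (-(m : ℤ)) * dyadicVal ρ :=
    mul_nonneg (by positivity) (dyadicVal_nonneg ρ)
  have hy' : (2 : ℝ) ^ (-(m : ℤ)) * dyadicVal ρ ≤ (2 : ℝ) ^ (-(m : ℤ)) :=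
    mul_le_of_le_one_right (by positivity) (dyadicVal_le_one ρ)
  have hC0 : 0 ≤ C := (abs_nonneg _).trans (hC 0 (by simp))
  have hsub : dyadicVal σ - dyadicVal τ = (2 : ℝ) ^ (-(m : ℤ)) * dyadicVal ρ := by
    rw [hsplit, add_sub_cancel_left]
  have htaylor := abs_sub_taylorWithinEval_le one_pos hdiff hC (dyadicVal_nonneg τ)
    (by linarith : dyadicVal τ ≤ dyadicVal σ) (dyadicVal_le_one σ)
  rw [taylor_within_apply, hsub, Finset.sum_range] at htaylor
  simp only [smul_eq_mul] at htaylor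
  simp only [mul_comm (iteratedDerivWithin _ f _ _)]
  refine htaylor.trans (le_trans ?_ hε)
  gcongr

/-- if `f` is `(p+1)`-times differentiable on `[0,1]` with `|f^{(p+1)}| ≤ C`,
`p ≥ 1`, `K > m ≥ 1`, `T` the quantized tensor representation of `f` on `D_K`, and `ε > 0`,
then `r_m^{(ε,∞)}[T] ≤ 1 + p + ⌈((4C/π)·2^{-m}/(pε))^{1/p}⌉`. -/
theorem stmt2 (f : ℝ → ℝ) (p : ℕ) (hp : 1 ≤ p) (C : ℝ)
    (hdiff : ∀ i ≤ p,
      DifferentiableOn ℝ (iteratedDerivWithin i f (Set.Icc (0 : ℝ) 1)) (Set.Icc (0 : ℝ) 1))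
    (hC : ∀ x ∈ Set.Icc (0 : ℝ) 1, |iteratedDerivWithin (p + 1) f (Set.Icc (0 : ℝ) 1) x| ≤ C)
    (K m : ℕ) (hm1 : 1 ≤ m) (hmK : m < K) (ε : ℝ) (hε : 0 < ε) :
    epsRank K m hmK.le (qtt f K) ε ≤
      1 + p + ⌈((4 * C / Real.pi) * (2 : ℝ) ^ (-(m : ℤ)) / (p * ε)) ^ ((1 : ℝ) / p)⌉₊ := by
  set A : ℝ := (4 * C / Real.pi) * (2 : ℝ) ^ (-(m : ℤ)) / (p * ε) with hA
  have hp0 : (0 : ℝ) < p := by exact_mod_cast hp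
  have hC0 : 0 ≤ C := (abs_nonneg _).trans (hC 0 (by simp))
  have hA0 : 0 ≤ A := by positivity
  rcases le_total (2 ^ m) (1 + p + ⌈A ^ ((1 : ℝ) / p)⌉₊) with h | h
  · exact (epsRank_le_two_pow K m hmK.le _ hε.le).trans h
  suffices hbound : C * ((2 : ℝ) ^ (-(m : ℤ))) ^ (p + 1) / p.factorial ≤ ε from
    (epsRank_qtt_le_of_taylor_bound hdiff hC hmK.le hbound).trans (by omega)
  have hroot : A ^ ((1 : ℝ) / p) ≤ (2 : ℝ) ^ m := by
    refine (Nat.le_ceil _).trans ?_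
    exact_mod_cast (Nat.le_add_left _ (1 + p)).trans h
  have hA_le : A ≤ ((2 : ℝ) ^ m) ^ p := by
    rw [one_div] at hroot
    rw [← Real.rpow_inv_natCast_pow hA0 (by omega : p ≠ 0)]
    gcongr
  have hfac : (p : ℝ) ≤ p.factorial := by exact_mod_cast Nat.self_le_factorial p
  rw [zpow_neg, zpow_natCast] at hA ⊢
  have hCA : C * ((2 : ℝ) ^ m)⁻¹ = A * (Real.pi / 4 * p * ε) := by
    rw [hA]
    field_simp
  rw [div_le_iff₀ (by positivity), pow_succ', ← mul_assoc, hCA, inv_pow,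
    ← div_eq_mul_inv, div_le_iff₀ (by positivity)]
  have hpi : Real.pi / 4 ≤ 1 := by linarith [Real.pi_le_four]
  calc A * (Real.pi / 4 * p * ε) ≤ ((2 : ℝ) ^ m) ^ p * (1 * p.factorial * ε) := by gcongr
    _ = ε * p.factorial * ((2 : ℝ) ^ m) ^ p := by ring
end
end

section
/- Suppose f : [0,1] → ℝ is the restriction to [0,1] of an Ω-bandlimited function with spectral measure μ. Then for all integers m ≥ 1 and N ≥ 1, the interpolation error satisfies E_{m,N}[f] ≤ (2|μ|/π) · e^{(2^{−m}Ω − N)/2}. -/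
noncomputable section

/-- The total variation `|μ|` of a finite signed measure. -/
def tv (μ : MeasureTheory.SignedMeasure ℝ) : ℝ :=
  (μ.totalVariation Set.univ).toReal

/-- The integral of a complex-valued function against a signed measure, via the
Jordan decomposition `μ = μ⁺ - μ⁻`. -/
def sintegral (μ : MeasureTheory.SignedMeasure ℝ) (g : ℝ → ℂ) : ℂ :=
  (∫ ω, g ω ∂μ.toJordanDecomposition.posPart) -
    ∫ ω, g ω ∂μ.toJordanDecomposition.negPart

/-- `g : ℝ → ℝ` is `Ω`-bandlimited with spectral measure `μ`: `μ` is a finite signed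
measure supported on `[-Ω,Ω]` and `g(x) = (1/(2π)) ∫ e^{iωx} dμ(ω)` for all `x`. -/
def IsBandlimited (Ω : ℝ) (μ : MeasureTheory.SignedMeasure ℝ) (g : ℝ → ℝ) : Prop :=
  μ.totalVariation (Set.Icc (-Ω) Ω)ᶜ = 0 ∧
    ∀ x : ℝ, (g x : ℂ) =
      (1 / (2 * (Real.pi : ℂ))) *
        sintegral μ (fun ω => Complex.exp (Complex.I * (ω : ℂ) * (x : ℂ)))

/-- Generalized Rolle theorem: a `C^n` function with `n + 1` zeros has an `n`-th derivative which
vanishes somewhere. -/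
theorem exists_iteratedDeriv_eq_zero_of_strictMono (n : ℕ) (f : ℝ → ℝ) (hf : ContDiff ℝ n f)
    (x : Fin (n + 1) → ℝ) (hx : StrictMono x) (h0 : ∀ i, f (x i) = 0) :
    ∃ ξ, iteratedDeriv n f ξ = 0 := by
  induction n generalizing f with
  | zero => exact ⟨x 0, by simpa using h0 0⟩
  | succ n ih =>
    have key : ∀ i : Fin (n + 1), ∃ c ∈ Set.Ioo (x i.castSucc) (x i.succ), deriv f c = 0 :=
      fun i => exists_deriv_eq_zero (hx Fin.castSucc_lt_succ) hf.continuous.continuousOn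
        (by rw [h0, h0])
    choose y hy hy0 using key
    rw [iteratedDeriv_succ']
    refine ih (deriv f) ?_ y ?_ hy0
    · exact ((contDiff_succ_iff_deriv (n := n)).1 (by exact_mod_cast hf)).2.2
    · refine Fin.strictMono_iff_lt_succ.2 fun i => ?_
      exact (hy i.castSucc).2.trans (hy i.succ).1

theorem exists_iteratedDeriv_eq_zero_of_card {n : ℕ} {f : ℝ → ℝ} (hf : ContDiff ℝ n f)
    (s : Finset ℝ) (hs : s.card = n + 1) (h0 : ∀ x ∈ s, f x = 0) :
    ∃ ξ, iteratedDeriv n f ξ = 0 :=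
  exists_iteratedDeriv_eq_zero_of_strictMono n f hf (s.orderEmbOfFin hs)
    (s.orderEmbOfFin hs).strictMono fun i => h0 _ (s.orderEmbOfFin_mem hs i)

theorem Polynomial.iteratedDeriv_eval (p : Polynomial ℝ) (n : ℕ) :
    iteratedDeriv n (fun x => p.eval x) = fun x => (Polynomial.derivative^[n] p).eval x := by
  induction n generalizing p with
  | zero => simp
  | succ n ih =>
    rw [iteratedDeriv_succ', Function.iterate_succ_apply, ← ih]
    congr 1
    ext x
    exact p.deriv

theorem Polynomial.Monic.iterate_derivative_natDegree {p : Polynomial ℝ} (hp : p.Monic) :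
    Polynomial.derivative^[p.natDegree] p = Polynomial.C (p.natDegree.factorial : ℝ) := by
  have hd : (Polynomial.derivative^[p.natDegree] p).natDegree ≤ 0 := by
    simpa using Polynomial.natDegree_iterate_derivative p p.natDegree
  rw [Polynomial.eq_C_of_natDegree_le_zero hd, Polynomial.coeff_iterate_derivative]
  simp [hp.coeff_natDegree, Nat.descFactorial_self]

/-- The Lagrange interpolation error bound. -/
theorem abs_sub_eval_interpolate_le {ι : Type*} [DecidableEq ι] {s : Finset ι} {node : ι → ℝ}
    (hnode : Set.InjOn node s) {f : ℝ → ℝ} (hf : ContDiff ℝ s.card f) {M : ℝ}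
    (hM : ∀ x, |iteratedDeriv s.card f x| ≤ M) (x : ℝ) :
    |f x - (Lagrange.interpolate s node fun i => f (node i)).eval x| ≤
      M / s.card.factorial * |(Lagrange.nodal s node).eval x| := by
  set p := Lagrange.interpolate s node fun i => f (node i) with hp
  set w := Lagrange.nodal s node with hw
  by_cases hx : w.eval x = 0
  · have : ∃ i ∈ s, x = node i := by
      rw [hw, Lagrange.eval_nodal, Finset.prod_eq_zero_iff] at hx
      obtain ⟨i, hi, h⟩ := hx
      exact ⟨i, hi, sub_eq_zero.1 h⟩
    obtain ⟨i, hi, rfl⟩ := this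
    rw [hp, Lagrange.eval_interpolate_at_node _ hnode hi, hx]
    simp
  · set K := (f x - p.eval x) / w.eval x with hK
    set q := p + Polynomial.C K * w with hq
    have hcard : (insert x (s.image node)).card = s.card + 1 := by
      rw [Finset.card_insert_of_notMem, Finset.card_image_of_injOn hnode]
      intro h
      obtain ⟨i, hi, rfl⟩ := Finset.mem_image.1 h
      exact hx (Lagrange.eval_nodal_at_node hi)
    have hqc : ContDiff ℝ s.card fun t => q.eval t := by
      simpa using q.contDiff_aeval (𝕜 := ℝ) (s.card : WithTop ℕ∞)
    obtain ⟨ξ, hξ⟩ := exists_iteratedDeriv_eq_zero_of_card (hf.sub hqc) _ hcard (by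
      intro t ht
      rcases Finset.mem_insert.1 ht with rfl | ht
      · simp [hq, hK, hx]
      · obtain ⟨i, hi, rfl⟩ := Finset.mem_image.1 ht
        have hpi : p.eval (node i) = f (node i) := Lagrange.eval_interpolate_at_node _ hnode hi
        simp [hq, hw, hpi, Lagrange.eval_nodal_at_node hi])
    have hwd : Polynomial.derivative^[s.card] w = Polynomial.C (s.card.factorial : ℝ) := by
      have := (Lagrange.nodal_monic (s := s) (v := node)).iterate_derivative_natDegree
      rwa [Lagrange.natDegree_nodal] at this
    have hpd : Polynomial.derivative^[s.card] p = 0 :=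
      Polynomial.iterate_derivative_eq_zero_of_degree_lt (Lagrange.degree_interpolate_lt _ hnode)
    have hval : iteratedDeriv s.card f ξ = K * s.card.factorial := by
      have h := iteratedDeriv_fun_sub (x := ξ) hf.contDiffAt hqc.contDiffAt
      rw [hξ, Polynomial.iteratedDeriv_eval] at h
      simp only [hq, iterate_map_add, hpd, Polynomial.iterate_derivative_C_mul, hwd,
        zero_add, Polynomial.eval_mul, Polynomial.eval_C] at h
      linarith
    have hfac : (0 : ℝ) < s.card.factorial := by exact_mod_cast Nat.factorial_pos _
    have hKM : |K| ≤ M / s.card.factorial := by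
      rw [le_div_iff₀ hfac, ← abs_of_pos hfac, ← abs_mul, ← hval]
      exact hM ξ
    calc |f x - p.eval x| = |K| * |w.eval x| := by rw [← abs_mul, hK, div_mul_cancel₀ _ hx]
      _ ≤ _ := by gcongr

theorem chebNode_injOn {N : ℕ} : Set.InjOn (chebNode N) (Finset.range (N + 1)) := by
  intro i hi j hj h
  refine (Polynomial.Chebyshev.strictAntiOn_node N).injOn hi hj ?_
  simp only [chebNode, Polynomial.Chebyshev.node, mul_comm Real.pi] at h ⊢
  linarith

theorem eval_basis_chebNode (N α : ℕ) (x : ℝ) :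
    (Lagrange.basis (Finset.range (N + 1)) (chebNode N) α).eval x = chebP N α x := by
  simp [Lagrange.basis, Lagrange.basisDivisor, Polynomial.eval_prod, chebP, div_eq_inv_mul]

theorem eval_U_real_eq_prod (n : ℕ) (x : ℝ) :
    (Polynomial.Chebyshev.U ℝ n).eval x =
      2 ^ n * ∏ k ∈ Finset.range n, (x - Real.cos ((k + 1) * Real.pi / (n + 1))) := by
  have hinj := (Finset.range n).nodup_map_iff_injOn.mp
    (Polynomial.Chebyshev.roots_U_real_nodup n)
  have hroots := Polynomial.Chebyshev.roots_U_real n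
  have hcard : (Polynomial.Chebyshev.U ℝ n).roots.card = (Polynomial.Chebyshev.U ℝ n).natDegree := by
    rw [hroots, Polynomial.Chebyshev.natDegree_U_natCast, Finset.card_val,
      Finset.card_image_of_injOn hinj, Finset.card_range]
  have h := Polynomial.C_leadingCoeff_mul_prod_multiset_X_sub_C hcard
  rw [← h, hroots, Polynomial.Chebyshev.leadingCoeff_U_natCast, ← Finset.prod_eq_multiset_prod,
    Finset.prod_image hinj]
  simp [Polynomial.eval_prod]

theorem abs_eval_nodal_chebNode_le {N : ℕ} (hN : 1 ≤ N) {v : ℝ} (hv : v ∈ Set.Icc (0 : ℝ) 1) :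
    |(Lagrange.nodal (Finset.range (N + 1)) (chebNode N)).eval v| ≤ (1 / 4) ^ N := by
  obtain ⟨n, rfl⟩ : ∃ n, N = n + 1 := ⟨N - 1, by omega⟩
  obtain ⟨θ, hθ⟩ : ∃ θ, Real.cos θ = 2 * v - 1 :=
    ⟨Real.arccos (2 * v - 1), Real.cos_arccos (by linarith [hv.1]) (by linarith [hv.2])⟩
  have hmid : ∏ k ∈ Finset.range n, (v - chebNode (n + 1) (k + 1)) =
      (1 / 2) ^ n *
        ∏ k ∈ Finset.range n, (Real.cos θ - Real.cos ((k + 1) * Real.pi / (n + 1))) := by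
    have h := Finset.prod_const (s := Finset.range n) (1 / 2 : ℝ)
    rw [Finset.card_range] at h
    rw [← h, ← Finset.prod_mul_distrib]
    refine Finset.prod_congr rfl fun k _ => ?_
    rw [hθ, chebNode, mul_comm Real.pi]
    push_cast
    ring
  have hlast : chebNode (n + 1) (n + 1) = 0 := by
    rw [chebNode, mul_div_cancel_right₀ _ (by positivity)]
    simp
  have hU := Polynomial.Chebyshev.U_real_cos θ n
  rw [eval_U_real_eq_prod, Int.cast_natCast] at hU
  have hprod : (Lagrange.nodal (Finset.range (n + 1 + 1)) (chebNode (n + 1))).eval v =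
      -((1 / 4) ^ (n + 1) * (Real.sin θ * Real.sin ((n + 1) * θ))) := by
    rw [Lagrange.eval_nodal, Finset.prod_range_succ, Finset.prod_range_succ', hmid, hlast]
    have h0 : chebNode (n + 1) 0 = 1 := by simp [chebNode]
    have hv' : v = (Real.cos θ + 1) / 2 := by linarith
    have hs := Real.sin_sq_add_cos_sq θ
    have h4 : (1 / 4 : ℝ) ^ n * 2 ^ n = (1 / 2) ^ n := by rw [← mul_pow]; norm_num
    rw [h0, ← hU, hv', pow_succ, ← h4]
    linear_combination (1 / 4 : ℝ) ^ n * (1 / 4) * 2 ^ n *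
      (∏ k ∈ Finset.range n, (Real.cos θ - Real.cos ((k + 1) * Real.pi / (n + 1)))) * hs
  rw [hprod, abs_neg, abs_mul, abs_mul, abs_of_nonneg (by positivity : (0 : ℝ) ≤ (1 / 4) ^ (n + 1))]
  refine mul_le_of_le_one_right (by positivity) ?_
  exact mul_le_one₀ (Real.abs_sin_le_one _) (abs_nonneg _) (Real.abs_sin_le_one _)

theorem abs_iteratedDeriv_cos_add_mul_le (n : ℕ) (a b x : ℝ) :
    |iteratedDeriv n (fun t => Real.cos (a * t + b)) x| ≤ |a| ^ n := by
  have h := congrFun (iteratedDeriv_comp_const_mul (n := n) (f := fun t => Real.cos (t + b))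
    (by fun_prop) a) x
  rw [h, iteratedDeriv_comp_add_const, abs_mul, abs_pow]
  exact mul_le_of_le_one_right (by positivity) (Real.abs_iteratedDeriv_cos_le_one _ _)

theorem pow_div_factorial_mul_le (N : ℕ) {A : ℝ} (hA : 0 ≤ A) :
    A ^ (N + 1) / (N + 1).factorial * (1 / 4) ^ N ≤ 4 * Real.exp ((A - N) / 2) := by
  have h1 := Real.pow_div_factorial_le_exp (A / 2) (by positivity) (N + 1)
  have h2 : (1 / 2 : ℝ) ^ N ≤ Real.exp (-(N : ℝ) / 2) := by
    have : Real.exp (-(N : ℝ) / 2) = Real.exp (-(1 / 2)) ^ N := by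
      rw [← Real.exp_nat_mul]; ring_nf
    rw [this]
    gcongr
    linarith [Real.add_one_le_exp (-(1 / 2) : ℝ)]
  calc A ^ (N + 1) / (N + 1).factorial * (1 / 4) ^ N
      = 2 * ((A / 2) ^ (N + 1) / (N + 1).factorial) * (1 / 2) ^ N := by
        have : (1 / 4 : ℝ) ^ N = (1 / 2) ^ N * (1 / 2) ^ N := by rw [← mul_pow]; norm_num
        rw [this, div_pow A 2, pow_succ 2 N, div_pow 1 2 N, one_pow]
        field_simp
    _ ≤ 4 * Real.exp (A / 2) * Real.exp (-(N : ℝ) / 2) := by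
        gcongr
        norm_num
    _ = _ := by rw [mul_assoc, ← Real.exp_add]; ring_nf

theorem abs_cos_sub_sum_chebP_le {N : ℕ} (hN : 1 ≤ N) (a b : ℝ) {A v : ℝ} (ha : |a| ≤ A)
    (hv : v ∈ Set.Icc (0 : ℝ) 1) :
    |Real.cos (a * v + b) -
      ∑ α ∈ Finset.range (N + 1), Real.cos (a * chebNode N α + b) * chebP N α v| ≤
      4 * Real.exp ((A - N) / 2) := by
  have h := abs_sub_eval_interpolate_le (s := Finset.range (N + 1)) chebNode_injOn
    (f := fun t => Real.cos (a * t + b)) (by fun_prop)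
    (abs_iteratedDeriv_cos_add_mul_le _ a b) v
  simp only [Lagrange.interpolate_apply, Polynomial.eval_finsetSum, Polynomial.eval_mul,
    Polynomial.eval_C, eval_basis_chebNode, Finset.card_range] at h
  have hA : 0 ≤ A := (abs_nonneg a).trans ha
  refine h.trans (le_trans ?_ (pow_div_factorial_mul_le N hA))
  gcongr
  exact abs_eval_nodal_chebNode_le hN hv

theorem integrable_cos_mul (ν : MeasureTheory.Measure ℝ) [MeasureTheory.IsFiniteMeasure ν]
    (x : ℝ) : MeasureTheory.Integrable (fun ω => Real.cos (ω * x)) ν :=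
  MeasureTheory.Integrable.of_bound (by fun_prop) 1
    (MeasureTheory.ae_of_all _ fun ω => Real.abs_cos_le_one _)

theorem re_integral_exp_I_mul (ν : MeasureTheory.Measure ℝ) [MeasureTheory.IsFiniteMeasure ν]
    (x : ℝ) : (∫ ω, Complex.exp (Complex.I * (ω : ℂ) * (x : ℂ)) ∂ν).re =
      ∫ ω, Real.cos (ω * x) ∂ν := by
  have hre : ∀ ω : ℝ, (Complex.exp (Complex.I * (ω : ℂ) * (x : ℂ))).re = Real.cos (ω * x) := by
    intro ω
    rw [show Complex.I * (ω : ℂ) * (x : ℂ) = ((ω * x : ℝ) : ℂ) * Complex.I by push_cast; ring,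
      Complex.exp_ofReal_mul_I_re]
  have hint : MeasureTheory.Integrable
      (fun ω : ℝ => Complex.exp (Complex.I * (ω : ℂ) * (x : ℂ))) ν := by
    refine MeasureTheory.Integrable.of_bound
      (Continuous.aestronglyMeasurable (by fun_prop)) 1 (MeasureTheory.ae_of_all _ fun ω => ?_)
    rw [show Complex.I * (ω : ℂ) * (x : ℂ) = ((ω * x : ℝ) : ℂ) * Complex.I by push_cast; ring,
      Complex.norm_exp_ofReal_mul_I]
  have h := integral_re hint
  simp only [RCLike.re_to_complex, hre] at h
  exact h.symm

theorem IsBandlimited.eq_integral_cos {Ω : ℝ} {μ : MeasureTheory.SignedMeasure ℝ} {g : ℝ → ℝ}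
    (hg : IsBandlimited Ω μ g) (x : ℝ) :
    g x = 1 / (2 * Real.pi) * ((∫ ω, Real.cos (ω * x) ∂μ.toJordanDecomposition.posPart) -
      ∫ ω, Real.cos (ω * x) ∂μ.toJordanDecomposition.negPart) := by
  have h := congrArg Complex.re (hg.2 x)
  rw [show (1 / (2 * (Real.pi : ℂ))) = ((1 / (2 * Real.pi) : ℝ) : ℂ) by push_cast; rfl,
    Complex.re_ofReal_mul, sintegral, Complex.sub_re, re_integral_exp_I_mul,
    re_integral_exp_I_mul] at h
  simpa using h

theorem abs_integral_cos_sub_sum_chebP_le {Ω : ℝ} {N : ℕ} (hN : 1 ≤ N)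
    (ν : MeasureTheory.Measure ℝ) [MeasureTheory.IsFiniteMeasure ν]
    (hν : ν (Set.Icc (-Ω) Ω)ᶜ = 0) (u : ℝ) {w v : ℝ} (hw : 0 ≤ w) (hv : v ∈ Set.Icc (0 : ℝ) 1) :
    |(∫ ω, Real.cos (ω * (u + w * v)) ∂ν) -
      ∑ α ∈ Finset.range (N + 1),
        (∫ ω, Real.cos (ω * (u + w * chebNode N α)) ∂ν) * chebP N α v| ≤
      4 * Real.exp ((w * Ω - N) / 2) * ν.real Set.univ := by
  simp_rw [← MeasureTheory.integral_mul_const]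
  rw [← MeasureTheory.integral_finsetSum _ fun α _ => (integrable_cos_mul ν _).mul_const _,
    ← MeasureTheory.integral_sub (integrable_cos_mul ν _)
      (MeasureTheory.integrable_finsetSum _ fun α _ => (integrable_cos_mul ν _).mul_const _),
    ← Real.norm_eq_abs]
  refine MeasureTheory.norm_integral_le_of_norm_le_const (μ := ν) ?_
  have hae : ∀ᵐ ω ∂ν, ω ∈ Set.Icc (-Ω) Ω := hν
  filter_upwards [hae] with ω hω
  have h := abs_cos_sub_sum_chebP_le hN (ω * w) (ω * u) (A := w * Ω) (by
    rw [abs_mul, abs_of_nonneg hw, mul_comm]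
    exact mul_le_mul_of_nonneg_left (abs_le.2 hω) hw) hv
  have hr : ∀ t, ω * (u + w * t) = ω * w * t + ω * u := fun t => by ring
  simpa only [hr, Real.norm_eq_abs] using h

/-- if `f : [0,1] → ℝ` is the restriction of an `Ω`-bandlimited function
with spectral measure `μ`, then `E_{m,N}[f] ≤ (2|μ|/π) e^{(2^{-m}Ω - N)/2}`, expressed as
the pointwise bound over all `u ∈ [0,1-2^{-m}]`, `v ∈ [0,1]`. -/
theorem stmt5 (Ω : ℝ) (hΩ : 0 < Ω) (μ : MeasureTheory.SignedMeasure ℝ) (g : ℝ → ℝ)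
    (hg : IsBandlimited Ω μ g) (m N : ℕ) (hm : 1 ≤ m) (hN : 1 ≤ N) :
    ∀ u ∈ Set.Icc (0 : ℝ) (1 - (2 : ℝ) ^ (-(m : ℤ))), ∀ v ∈ Set.Icc (0 : ℝ) 1,
      |g (u + (2 : ℝ) ^ (-(m : ℤ)) * v) -
        ∑ α ∈ Finset.range (N + 1),
          g (u + (2 : ℝ) ^ (-(m : ℤ)) * chebNode N α) * chebP N α v|
        ≤ (2 * tv μ / Real.pi) * Real.exp (((2 : ℝ) ^ (-(m : ℤ)) * Ω - N) / 2) := by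
  intro u _ v hv
  have hw : (0 : ℝ) ≤ (2 : ℝ) ^ (-(m : ℤ)) := by positivity
  generalize (2 : ℝ) ^ (-(m : ℤ)) = w at hw ⊢
  have hnull := hg.1
  rw [MeasureTheory.SignedMeasure.totalVariation, MeasureTheory.Measure.add_apply,
    add_eq_zero] at hnull
  have hp := abs_integral_cos_sub_sum_chebP_le hN _ hnull.1 u hw hv
  have hn := abs_integral_cos_sub_sum_chebP_le hN _ hnull.2 u hw hv
  have htv : tv μ = μ.toJordanDecomposition.posPart.real Set.univ +
      μ.toJordanDecomposition.negPart.real Set.univ := by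
    rw [tv, MeasureTheory.SignedMeasure.totalVariation, MeasureTheory.Measure.add_apply,
      ENNReal.toReal_add (MeasureTheory.measure_ne_top _ _) (MeasureTheory.measure_ne_top _ _)]
    rfl
  simp_rw [hg.eq_integral_cos, mul_assoc, sub_mul]
  rw [← Finset.mul_sum, Finset.sum_sub_distrib, ← mul_sub, sub_sub_sub_comm, abs_mul,
    abs_of_pos (by positivity : 0 < 1 / (2 * Real.pi)), htv]
  refine (mul_le_mul_of_nonneg_left ((abs_sub _ _).trans (add_le_add hp hn))
    (by positivity)).trans_eq ?_
  field_simp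
  ring
end
end
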